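/- arXiv:1809.10737 — 2 statements merged into one kernel-verified Lean document; each statement's English description precedes it below -/
import Mathlib

section
/- Let r : ℕ → ℝ be a positive function with n·r(n) → ∞ and n^{2/3}·r(n) → 0 as n → ∞. Then the probability that the random geometric graph G(n, r(n)) has at least one edge and that every edge of G(n, r(n)) is free tends to 1 as n → ∞. -/
open MeasureTheory Filter

noncomputable section

/-- The unit square `[0,1]²` in the Euclidean plane. -/
def unitSquare : Set (EuclideanSpace ℝ (Fin 2)) := {x | ∀ i, x i ∈ Set.Icc (0 : ℝ) 1}

/-- The distribution of `n` independent uniform points in the unit square. -/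
def sqMeasure (n : ℕ) : Measure (Fin n → EuclideanSpace ℝ (Fin 2)) :=
  Measure.pi fun _ => volume.restrict unitSquare

/-- The random geometric graph on `n` points `x 0, …, x (n-1)` with distance parameter `r`:
distinct `i`, `j` are adjacent iff `dist (x i) (x j) ≤ r`. -/
def geomGraph (n : ℕ) (r : ℝ) (x : Fin n → EuclideanSpace ℝ (Fin 2)) : SimpleGraph (Fin n) where
  Adj i j := i ≠ j ∧ dist (x i) (x j) ≤ r
  symm := ⟨fun i j h => ⟨h.1.symm, by rw [dist_comm]; exact h.2⟩⟩
  loopless := ⟨fun i h => h.1 rfl⟩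

/-- An edge `{i,j}` of the random geometric graph is free if no other edge `{k,l}` of the
graph has its segment meeting the open segment between `x i` and `x j`
(the segment minus its endpoints). -/
def IsFreeEdge (n : ℕ) (r : ℝ) (x : Fin n → EuclideanSpace ℝ (Fin 2)) (i j : Fin n) : Prop :=
  (geomGraph n r x).Adj i j ∧
    ∀ k l : Fin n, (geomGraph n r x).Adj k l → ({k, l} : Finset (Fin n)) ≠ {i, j} →
      ∀ p ∈ segment ℝ (x k) (x l), ¬(p ∈ segment ℝ (x i) (x j) ∧ p ≠ x i ∧ p ≠ x j)

/-- axis-parallel box -/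
def bx (a b c d : ℝ) : Set (EuclideanSpace ℝ (Fin 2)) :=
  {x | x 0 ∈ Set.Icc a b ∧ x 1 ∈ Set.Icc c d}

lemma vol_bx (a b c d : ℝ) :
    volume (bx a b c d) = ENNReal.ofReal (b - a) * ENNReal.ofReal (d - c) := by
  have h : bx a b c d = (WithLp.ofLp : EuclideanSpace ℝ (Fin 2) → (Fin 2 → ℝ)) ⁻¹'
      (Set.univ.pi (fun i => Set.Icc (![a, c] i) (![b, d] i))) := by
    ext x
    simp only [bx, Set.mem_preimage, Set.mem_univ_pi, Fin.forall_fin_two]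
    rfl
  rw [h, (PiLp.volume_preserving_ofLp (Fin 2)).measure_preimage]
  · rw [volume_pi, Measure.pi_pi]; simp [Fin.prod_univ_two, Real.volume_Icc]
  · exact (MeasurableSet.univ_pi fun i => measurableSet_Icc).nullMeasurableSet

lemma unitSquare_eq : unitSquare = bx 0 1 0 1 := by
  ext x
  simp [bx, unitSquare, Fin.forall_fin_two]

instance : IsProbabilityMeasure
    ((volume : Measure (EuclideanSpace ℝ (Fin 2))).restrict unitSquare) :=
  ⟨by rw [Measure.restrict_apply_univ, unitSquare_eq, vol_bx]; simp⟩

instance (n : ℕ) : IsProbabilityMeasure (sqMeasure n) := by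
  unfold sqMeasure; infer_instance

lemma null_fiber (n : ℕ) (l : Fin n) (S : Set (Fin n → EuclideanSpace ℝ (Fin 2)))
    (hS : MeasurableSet S)
    (h : ∀ x, volume {y | Function.update x l y ∈ S} = 0) : sqMeasure n S = 0 := by
  have hf : Measurable (S.indicator (fun _ => (1 : ENNReal))) := measurable_const.indicator hS
  rw [← lintegral_indicator_one hS]
  unfold sqMeasure
  have h1 := lmarginal_univ (μ := fun _ : Fin n =>
    (volume : Measure (EuclideanSpace ℝ (Fin 2))).restrict unitSquare)
    (f := S.indicator (fun _ => (1 : ENNReal)))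
  have h2 := lmarginal_erase' (μ := fun _ : Fin n =>
    (volume : Measure (EuclideanSpace ℝ (Fin 2))).restrict unitSquare) _ hf
    (Finset.mem_univ l)
  have h3 : (fun x => ∫⁻ y, (S.indicator (fun _ => (1 : ENNReal)))
      (Function.update x l y) ∂((volume : Measure (EuclideanSpace ℝ (Fin 2))).restrict unitSquare))
      = 0 := by
    ext x
    have hm : MeasurableSet {y | Function.update x l y ∈ S} :=
      (measurable_update x) hS
    have : (fun y => (S.indicator (fun _ => (1 : ENNReal))) (Function.update x l y))
      = Set.indicator {y | Function.update x l y ∈ S} 1 := by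
      ext y; simp [Set.indicator]
    rw [this, lintegral_indicator_one hm]
    exact le_antisymm ((Measure.restrict_apply_le _ _).trans (h x).le) bot_le
  rw [h3] at h2
  have h4 := congrFun (h2) (fun _ => 0)
  rw [h1] at h4
  simp [lmarginal] at h4
  exact h4

def colS (n : ℕ) (i j l : Fin n) : Set (Fin n → EuclideanSpace ℝ (Fin 2)) :=
  {x | x i ≠ x j ∧ (x j 0 - x i 0) * (x l 1 - x i 1) = (x j 1 - x i 1) * (x l 0 - x i 0)}

lemma vol_line (u v : EuclideanSpace ℝ (Fin 2)) (huv : u ≠ v) :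
    volume {y : EuclideanSpace ℝ (Fin 2) |
      (v 0 - u 0) * (y 1 - u 1) = (v 1 - u 1) * (y 0 - u 0)} = 0 := by
  let φ : EuclideanSpace ℝ (Fin 2) →ₗ[ℝ] ℝ :=
    { toFun := fun y => (v 0 - u 0) * y 1 - (v 1 - u 1) * y 0
      map_add' := by intro x y; simp; ring
      map_smul' := by intro x y; simp; ring }
  have hne : AffineSubspace.mk' u (LinearMap.ker φ) ≠ ⊤ := by
    intro h
    have : (u + !₂[-(v 1 - u 1), v 0 - u 0]) ∈ AffineSubspace.mk' u (LinearMap.ker φ) := by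
      rw [h]; trivial
    rw [AffineSubspace.mem_mk'] at this
    simp [φ] at this
    apply huv
    have h0 : v 0 - u 0 = 0 := by nlinarith [mul_self_nonneg (v 0 - u 0), mul_self_nonneg (v 1 - u 1)]
    have h1 : v 1 - u 1 = 0 := by nlinarith [mul_self_nonneg (v 0 - u 0), mul_self_nonneg (v 1 - u 1)]
    ext i
    fin_cases i <;> simp <;> linarith
  refine measure_mono_null ?_ (Measure.addHaar_affineSubspace volume _ hne)
  intro y hy
  simp only [Set.mem_ofPred_eq] at hy
  rw [SetLike.mem_coe, AffineSubspace.mem_mk']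
  simp [φ]
  linarith

lemma colS_null (n : ℕ) (i j l : Fin n) (hi : i ≠ l) (hj : j ≠ l) :
    sqMeasure n (colS n i j l) = 0 := by
  apply null_fiber n l
  · apply MeasurableSet.inter
    · exact (isClosed_eq (continuous_apply i) (continuous_apply j)).measurableSet.compl
    · exact (isClosed_eq (by fun_prop) (by fun_prop)).measurableSet
  · intro x
    by_cases h : x i = x j
    · simp [colS, hi, hj, h]
    · refine measure_mono_null ?_ (vol_line _ _ h)
      intro y hy
      simpa [colS, hi, hj, h] using hy

lemma seg_col (a b c p : EuclideanSpace ℝ (Fin 2)) (h1 : p ∈ segment ℝ a b)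
    (h2 : p ∈ segment ℝ a c) (hp : p ≠ a) :
    a ≠ b ∧ (b 0 - a 0) * (c 1 - a 1) = (b 1 - a 1) * (c 0 - a 0) := by
  refine ⟨by rintro rfl; simp at h1; exact hp h1, ?_⟩
  rw [segment_eq_image'] at h1 h2
  obtain ⟨s, -, rfl⟩ := h1
  obtain ⟨t, -, ht⟩ := h2
  have hs : s ≠ 0 := by rintro rfl; simp at hp
  have ht0 : t ≠ 0 := by rintro rfl; simp at ht; apply hp; simpa using ht
  have e0 := congrArg (fun z : EuclideanSpace ℝ (Fin 2) => z 0) ht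
  have e1 := congrArg (fun z : EuclideanSpace ℝ (Fin 2) => z 1) ht
  simp at e0 e1
  apply mul_left_cancel₀ (mul_ne_zero hs ht0)
  linear_combination (s * (b 0 - a 0)) * e1 - (s * (b 1 - a 1)) * e0

def cell (m : ℕ) (c : Fin m × Fin m) : Set (EuclideanSpace ℝ (Fin 2)) :=
  bx ((c.1 : ℕ) / (m : ℝ)) (((c.1 : ℕ) + 1) / (m : ℝ))
    ((c.2 : ℕ) / (m : ℝ)) (((c.2 : ℕ) + 1) / (m : ℝ))

lemma exists_idx (m : ℕ) (hm : 0 < m) (t : ℝ) (ht : t ∈ Set.Icc (0 : ℝ) 1) :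
    ∃ a : Fin m, t ∈ Set.Icc (((a : ℕ) : ℝ) / m) (((a : ℕ) + 1) / (m : ℝ)) := by
  have hm' : (0 : ℝ) < m := by exact_mod_cast hm
  obtain ⟨h0, h1⟩ := ht
  rcases h1.lt_or_eq with h1 | rfl
  · have hlt : ⌊t * m⌋₊ < m := by
      rw [Nat.floor_lt (by positivity)]
      nlinarith
    refine ⟨⟨⌊t * m⌋₊, hlt⟩, ?_, ?_⟩
    · rw [div_le_iff₀ hm']
      exact Nat.floor_le (by positivity)
    · rw [le_div_iff₀ hm']
      exact (Nat.lt_floor_add_one _).le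
  · refine ⟨⟨m - 1, by omega⟩, ?_, ?_⟩
    · rw [div_le_iff₀ hm']
      simp
    · rw [le_div_iff₀ hm']
      have : ((m - 1 : ℕ) : ℝ) = m - 1 := by rw [Nat.cast_sub (by omega)]; simp
      simp [this]

lemma exists_cell (m : ℕ) (hm : 0 < m) (x : EuclideanSpace ℝ (Fin 2)) (hx : x ∈ unitSquare) :
    ∃ c, x ∈ cell m c := by
  obtain ⟨a, ha⟩ := exists_idx m hm (x 0) (hx 0)
  obtain ⟨b, hb⟩ := exists_idx m hm (x 1) (hx 1)
  exact ⟨(a, b), ha, hb⟩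

lemma vol_cell (m : ℕ) (c) : volume (cell m c) = ENNReal.ofReal (1 / (m : ℝ) ^ 2) := by
  have h (z : ℝ) : (z + 1) / (m : ℝ) - z / m = 1 / m := by ring
  rw [cell, vol_bx, h, h, ← ENNReal.ofReal_mul (by positivity)]
  congr 1
  ring

lemma dist_le_of_bx (a b c d s : ℝ) (x y : EuclideanSpace ℝ (Fin 2)) (hs : 0 ≤ s)
    (h1 : b - a ≤ s) (h2 : d - c ≤ s)
    (hx : x ∈ bx a b c d) (hy : y ∈ bx a b c d) : dist x y ≤ 2 * s := by
  obtain ⟨⟨hx1, hx2⟩, hx3, hx4⟩ := hx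
  obtain ⟨⟨hy1, hy2⟩, hy3, hy4⟩ := hy
  rw [EuclideanSpace.dist_eq, Fin.sum_univ_two, Real.dist_eq, Real.dist_eq, sq_abs, sq_abs]
  apply Real.sqrt_le_iff.2 ⟨by positivity, ?_⟩
  have e1 : (x 0 - y 0) ^ 2 ≤ s ^ 2 := by
    apply sq_le_sq' <;> linarith
  have e2 : (x 1 - y 1) ^ 2 ≤ s ^ 2 := by
    apply sq_le_sq' <;> linarith
  nlinarith

lemma coord_le_dist (x y : EuclideanSpace ℝ (Fin 2)) (i : Fin 2) : |x i - y i| ≤ dist x y := by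
  rw [dist_eq_norm]
  simpa using PiLp.norm_apply_le (x - y) i

lemma descFact_le (M n : ℕ) (hM : 0 < M) :
    (M.descFactorial n : ℝ) * (1 / (M : ℝ)) ^ n ≤ Real.exp (-((n : ℝ) * (n - 1) / 2 / M)) := by
  have hM' : (0 : ℝ) < M := by exact_mod_cast hM
  induction n with
  | zero => simp
  | succ k ih =>
    rw [Nat.descFactorial_succ, pow_succ]
    push_cast
    have h1 : ((M - k : ℕ) : ℝ) * (1 / M) ≤ Real.exp (-(k / M)) := by
      rcases le_or_gt k M with h | h
      · rw [Nat.cast_sub h]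
        have := Real.one_sub_le_exp_neg ((k : ℝ) / M)
        calc ((M : ℝ) - k) * (1 / M) = 1 - k / M := by field_simp
          _ ≤ _ := this
      · rw [Nat.sub_eq_zero_of_le h.le]
        simp
        positivity
    calc _ = (((M - k : ℕ) : ℝ) * (1 / M)) * ((M.descFactorial k : ℝ) * (1 / (M : ℝ)) ^ k) := by ring
      _ ≤ Real.exp (-(k / M)) * Real.exp (-((k : ℝ) * (k - 1) / 2 / M)) := by gcongr
      _ = _ := by
        rw [← Real.exp_add]
        congr 1
        ring

lemma no_edge_le (n : ℕ) (r : ℝ) (m : ℕ) (hm : 0 < m) (hmr : 2 / (m : ℝ) ≤ r) :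
    sqMeasure n {x | (∀ q, x q ∈ unitSquare) ∧ ∀ i j, i ≠ j → ¬ dist (x i) (x j) ≤ r} ≤
      ENNReal.ofReal (Real.exp (-((n : ℝ) * (n - 1) / 2 / (m : ℝ) ^ 2))) := by
  have hm' : (0 : ℝ) < m := by exact_mod_cast hm
  have hsub : {x : Fin n → EuclideanSpace ℝ (Fin 2) |
      (∀ q, x q ∈ unitSquare) ∧ ∀ i j, i ≠ j → ¬ dist (x i) (x j) ≤ r} ⊆
      ⋃ f : Fin n ↪ (Fin m × Fin m), Set.univ.pi (fun q => cell m (f q)) := by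
    rintro x ⟨hx, hd⟩
    choose f hf using fun q => exists_cell m hm (x q) (hx q)
    have hinj : Function.Injective f := by
      intro i j hij
      by_contra hne
      apply hd i j hne
      have hj := hf j
      rw [← hij] at hj
      refine (dist_le_of_bx _ _ _ _ (1 / (m : ℝ)) _ _ (by positivity) ?_ ?_ (hf i) hj).trans ?_
      · apply le_of_eq; ring
      · apply le_of_eq; ring
      · refine le_trans (le_of_eq ?_) hmr; ring
    exact Set.mem_iUnion.2 ⟨⟨f, hinj⟩, fun q _ => hf q⟩
  refine (measure_mono hsub).trans ((measure_iUnion_fintype_le _ _).trans ?_)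
  have hone : ∀ f : Fin n ↪ (Fin m × Fin m), sqMeasure n (Set.univ.pi (fun q => cell m (f q))) ≤
      ENNReal.ofReal ((1 / (m : ℝ) ^ 2) ^ n) := by
    intro f
    rw [sqMeasure, Measure.pi_pi, ENNReal.ofReal_pow (by positivity)]
    calc _ ≤ ∏ q : Fin n, ENNReal.ofReal (1 / (m : ℝ) ^ 2) := by
          gcongr with q
          exact (Measure.restrict_apply_le _ _).trans (vol_cell m _).le
      _ = _ := by simp
  refine (Finset.sum_le_sum fun f _ => hone f).trans ?_
  rw [Finset.sum_const, Finset.card_univ, Fintype.card_embedding_eq, nsmul_eq_mul]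
  rw [← ENNReal.ofReal_natCast, ← ENNReal.ofReal_mul (by positivity)]
  apply ENNReal.ofReal_le_ofReal
  have := descFact_le (m ^ 2) n (by positivity)
  simpa [sq] using this

def quad (n : ℕ) (r : ℝ) (i j k l : Fin n) : Set (Fin n → EuclideanSpace ℝ (Fin 2)) :=
  {x | x i ∈ unitSquare ∧ ∀ q ∈ ({j, k, l} : Finset (Fin n)), dist (x q) (x i) ≤ 2 * r}

lemma quad_le (n : ℕ) (r : ℝ) (hr : 0 < r) (i j k l : Fin n) (hij : i ≠ j) (hik : i ≠ k) (hil : i ≠ l)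
    (hjk : j ≠ k) (hjl : j ≠ l) (hkl : k ≠ l) (m : ℕ) (hm : 0 < m) (hmr : 1 / (m : ℝ) ≤ r) :
    sqMeasure n (quad n r i j k l) ≤ ENNReal.ofReal ((5 * r) ^ 6) := by
  have hm' : (0 : ℝ) < m := by exact_mod_cast hm
  let big (c : Fin m × Fin m) : Set (EuclideanSpace ℝ (Fin 2)) :=
    bx ((c.1 : ℕ) / (m : ℝ) - 2 * r) (((c.1 : ℕ) + 1) / (m : ℝ) + 2 * r)
      ((c.2 : ℕ) / (m : ℝ) - 2 * r) (((c.2 : ℕ) + 1) / (m : ℝ) + 2 * r)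
  have hbig : ∀ c, volume (big c) ≤ ENNReal.ofReal ((5 * r) ^ 2) := by
    intro c
    have h (z : ℝ) : ((z + 1) / (m : ℝ) + 2 * r) - (z / m - 2 * r) ≤ 5 * r := by
      have : (z + 1) / (m : ℝ) - z / m = 1 / m := by ring
      linarith
    rw [vol_bx, sq, ENNReal.ofReal_mul (by positivity)]
    gcongr <;> exact h _
  let T (c : Fin m × Fin m) (q : Fin n) : Set (EuclideanSpace ℝ (Fin 2)) :=
    if q = i then cell m c else if q ∈ ({j, k, l} : Finset (Fin n)) then big c else Set.univ
  have hsub : quad n r i j k l ⊆ ⋃ c, Set.univ.pi (T c) := by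
    rintro x ⟨hx, hd⟩
    obtain ⟨c, hc⟩ := exists_cell m hm _ hx
    refine Set.mem_iUnion.2 ⟨c, fun q _ => ?_⟩
    by_cases hq : q = i
    · simp only [T, hq, if_true]; exact hc
    by_cases hq2 : q ∈ ({j, k, l} : Finset (Fin n))
    · simp only [T, hq, hq2, if_true, if_false]
      have hdq := hd q hq2
      have e0 := abs_le.1 ((coord_le_dist (x q) (x i) 0).trans hdq)
      have e1 := abs_le.1 ((coord_le_dist (x q) (x i) 1).trans hdq)
      obtain ⟨⟨c1, c2⟩, c3, c4⟩ := hc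
      exact ⟨⟨by linarith, by linarith⟩, by linarith, by linarith⟩
    · simp only [T, hq, hq2, if_false]; trivial
  refine (measure_mono hsub).trans ((measure_iUnion_fintype_le _ _).trans ?_)
  have hone : ∀ c, sqMeasure n (Set.univ.pi (T c)) ≤
      ENNReal.ofReal (1 / (m : ℝ) ^ 2 * (5 * r) ^ 6) := by
    intro c
    rw [sqMeasure, Measure.pi_pi]
    rw [← Finset.prod_subset (Finset.subset_univ ({i, j, k, l} : Finset (Fin n)))]
    · rw [Finset.prod_insert (by simp [hij, hik, hil]), Finset.prod_insert (by simp [hjk, hjl]),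
        Finset.prod_insert (by simp [hkl]), Finset.prod_singleton]
      have : (1 / (m : ℝ) ^ 2 * (5 * r) ^ 6) =
        (1 / (m : ℝ) ^ 2) * ((5 * r) ^ 2 * ((5 * r) ^ 2 * (5 * r) ^ 2)) := by ring
      rw [this, ENNReal.ofReal_mul (by positivity), ENNReal.ofReal_mul (by positivity),
        ENNReal.ofReal_mul (by positivity)]
      gcongr
      · simp only [T, if_true]
        exact (Measure.restrict_apply_le _ _).trans (vol_cell m _).le
      · simp only [T, hij.symm, if_false]
        simp only [Finset.mem_insert, true_or, if_true]
        exact (Measure.restrict_apply_le _ _).trans (hbig c)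
      · simp only [T, hik.symm, if_false]
        simp only [Finset.mem_insert, true_or, or_true, if_true]
        exact (Measure.restrict_apply_le _ _).trans (hbig c)
      · simp only [T, hil.symm, if_false]
        simp only [Finset.mem_insert, Finset.mem_singleton, or_true, if_true]
        exact (Measure.restrict_apply_le _ _).trans (hbig c)
    · intro q _ hq
      simp only [Finset.mem_insert, not_or] at hq
      have : T c q = Set.univ := by
        have h2 : q ∉ ({j, k, l} : Finset (Fin n)) := by simpa using hq.2
        simp only [T, hq.1, h2, if_false]
      rw [this]
      exact measure_univ
  refine (Finset.sum_le_sum fun f _ => hone f).trans ?_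
  rw [Finset.sum_const, Finset.card_univ, nsmul_eq_mul]
  rw [← ENNReal.ofReal_natCast, ← ENNReal.ofReal_mul (by positivity)]
  apply ENNReal.ofReal_le_ofReal
  apply le_of_eq
  simp
  field_simp

def badQuad (n : ℕ) (r : ℝ) (t : Fin n × Fin n × Fin n × Fin n) :
    Set (Fin n → EuclideanSpace ℝ (Fin 2)) :=
  {x | x ∈ quad n r t.1 t.2.1 t.2.2.1 t.2.2.2 ∧
    t.1 ≠ t.2.1 ∧ t.1 ≠ t.2.2.1 ∧ t.1 ≠ t.2.2.2 ∧ t.2.1 ≠ t.2.2.1 ∧ t.2.1 ≠ t.2.2.2 ∧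
    t.2.2.1 ≠ t.2.2.2}

def badTriple (n : ℕ) (t : Fin n × Fin n × Fin n) : Set (Fin n → EuclideanSpace ℝ (Fin 2)) :=
  {x | x ∈ colS n t.1 t.2.1 t.2.2 ∧ t.1 ≠ t.2.2 ∧ t.2.1 ≠ t.2.2}

def good (n : ℕ) (r : ℝ) : Set (Fin n → EuclideanSpace ℝ (Fin 2)) :=
  {x | (∃ i j : Fin n, (geomGraph n r x).Adj i j) ∧
          ∀ i j : Fin n, (geomGraph n r x).Adj i j → IsFreeEdge n r x i j}

lemma dist_seg {a b p : EuclideanSpace ℝ (Fin 2)} (h : p ∈ segment ℝ a b) :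
    dist a p ≤ dist a b ∧ dist b p ≤ dist a b := by
  have := dist_add_dist_of_mem_segment h
  have h1 := dist_nonneg (x := a) (y := p)
  have h2 := dist_nonneg (x := p) (y := b)
  rw [dist_comm b p]
  constructor <;> linarith

lemma good_compl (n : ℕ) (r : ℝ) : (good n r)ᶜ ⊆
    (⋃ q : Fin n, {x | x q ∉ unitSquare}) ∪
    ({x | (∀ q, x q ∈ unitSquare) ∧ ∀ i j, i ≠ j → ¬ dist (x i) (x j) ≤ r} ∪
    ((⋃ t, badQuad n r t) ∪ ⋃ t, badTriple n t)) := by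
  intro x hx
  by_cases hsq : ∀ q, x q ∈ unitSquare
  swap
  · left
    push Not at hsq
    obtain ⟨q, hq⟩ := hsq
    exact Set.mem_iUnion.2 ⟨q, hq⟩
  right
  by_cases hE : ∃ i j : Fin n, (geomGraph n r x).Adj i j
  swap
  · left
    exact ⟨hsq, fun i j hij hd => hE ⟨i, j, hij, hd⟩⟩
  right
  by_contra hcon
  apply hx
  refine ⟨hE, fun i j hij => ⟨hij, ?_⟩⟩
  rintro k l hkl hne p hp ⟨hp2, hpi, hpj⟩
  apply hcon
  have key : ∀ a b c : Fin n, p ∈ segment ℝ (x a) (x b) → p ∈ segment ℝ (x a) (x c) →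
      p ≠ x a → a ≠ c → b ≠ c →
      x ∈ (⋃ t, badQuad n r t) ∪ ⋃ t, badTriple n t := by
    intro a b c h1 h2 h3 h4 h5
    right
    exact Set.mem_iUnion.2 ⟨(a, b, c), seg_col _ _ _ _ h1 h2 h3, h4, h5⟩
  have hp' := hp
  have hp2' := hp2
  rw [segment_symm] at hp' hp2'
  by_cases hki : k = i
  · subst hki
    exact key k j l hp2 hp hpi hkl.1 (by rintro rfl; exact hne rfl)
  by_cases hkj : k = j
  · subst hkj
    exact key k i l hp2' hp hpj hkl.1 (by rintro rfl; exact hne (Finset.pair_comm _ _))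
  by_cases hli : l = i
  · subst hli
    exact key l j k hp2 hp' hpi hkl.1.symm (fun h => hkj h.symm)
  by_cases hlj : l = j
  · subst hlj
    exact key l i k hp2' hp' hpj hkl.1.symm (fun h => hki h.symm)
  left
  refine Set.mem_iUnion.2 ⟨(i, j, k, l), ⟨hsq i, ?_⟩, hij.1, fun h => hki h.symm,
    fun h => hli h.symm, fun h => hkj h.symm, fun h => hlj h.symm, hkl.1⟩
  have d1 := dist_seg hp
  have d2 := dist_seg hp2
  have hij2 := hij.2
  have hkl2 := hkl.2
  intro q hq
  have hqp : dist (x q) p ≤ r := by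
    simp only [Finset.mem_insert, Finset.mem_singleton] at hq
    rcases hq with rfl | rfl | rfl <;> linarith [d1.1, d1.2, d2.1, d2.2]
  have := dist_triangle_right (x q) (x i) p
  linarith [d2.1]

lemma bad_le (n : ℕ) (r : ℝ) (hr : 0 < r) (m : ℕ) (hm : 0 < m) (hmr : 2 / (m : ℝ) ≤ r) :
    sqMeasure n (good n r)ᶜ ≤
      ENNReal.ofReal (Real.exp (-((n : ℝ) * (n - 1) / 2 / (m : ℝ) ^ 2)) + n ^ 4 * (5 * r) ^ 6) := by
  have hm' : (0 : ℝ) < m := by exact_mod_cast hm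
  have hmr2 : 1 / (m : ℝ) ≤ r := le_trans (by gcongr; norm_num) hmr
  have h1 : sqMeasure n (⋃ q : Fin n, {x | x q ∉ unitSquare}) = 0 := by
    rw [measure_iUnion_null_iff]
    intro q
    have hms : MeasurableSet unitSquare := by
      have : unitSquare = ⋂ i, {x : EuclideanSpace ℝ (Fin 2) | x i ∈ Set.Icc (0 : ℝ) 1} := by
        ext; simp [unitSquare]
      rw [this]
      refine MeasurableSet.iInter fun i => ?_
      exact (isClosed_Icc.preimage (by fun_prop : Continuous
        (fun x : EuclideanSpace ℝ (Fin 2) => x i))).measurableSet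
    have h0 : (volume.restrict unitSquare) (unitSquareᶜ) = 0 := by
      rw [Measure.restrict_apply hms.compl]; simp
    exact Measure.pi_eval_preimage_null (fun _ : Fin n => volume.restrict unitSquare) (i := q) h0
  have h2 := no_edge_le n r m hm hmr
  have h3 : sqMeasure n (⋃ t, badQuad n r t) ≤ ENNReal.ofReal (n ^ 4 * (5 * r) ^ 6) := by
    refine (measure_iUnion_fintype_le _ _).trans ?_
    have hone : ∀ t, sqMeasure n (badQuad n r t) ≤ ENNReal.ofReal ((5 * r) ^ 6) := by
      rintro ⟨i, j, k, l⟩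
      by_cases h : i ≠ j ∧ i ≠ k ∧ i ≠ l ∧ j ≠ k ∧ j ≠ l ∧ k ≠ l
      · exact (measure_mono fun x hx => hx.1).trans (quad_le n r hr i j k l h.1 h.2.1 h.2.2.1
          h.2.2.2.1 h.2.2.2.2.1 h.2.2.2.2.2 m hm hmr2)
      · have : badQuad n r (i, j, k, l) = ∅ := by
          ext x; exact ⟨fun hx => (h hx.2).elim, fun hx => hx.elim⟩
        rw [this]; simp
    refine (Finset.sum_le_sum fun f _ => hone f).trans ?_
    rw [Finset.sum_const, Finset.card_univ, nsmul_eq_mul]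
    rw [← ENNReal.ofReal_natCast, ← ENNReal.ofReal_mul (by positivity)]
    apply ENNReal.ofReal_le_ofReal
    apply le_of_eq
    simp only [Fintype.card_prod, Fintype.card_fin]
    push_cast
    ring
  have h4 : sqMeasure n (⋃ t, badTriple n t) = 0 := by
    rw [measure_iUnion_null_iff]
    rintro ⟨i, j, l⟩
    by_cases h : i ≠ l ∧ j ≠ l
    · exact measure_mono_null (fun x hx => hx.1) (colS_null n i j l h.1 h.2)
    · have : badTriple n (i, j, l) = ∅ := by
        ext x; exact ⟨fun hx => (h hx.2).elim, fun hx => hx.elim⟩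
      rw [this]; simp
  refine (measure_mono (good_compl n r)).trans ?_
  refine (measure_union_le _ _).trans ?_
  rw [h1, zero_add]
  refine (measure_union_le _ _).trans ?_
  rw [ENNReal.ofReal_add (by positivity) (by positivity)]
  refine add_le_add h2 ?_
  refine (measure_union_le _ _).trans ?_
  rw [h4, add_zero]
  exact h3

lemma bad_le' (n : ℕ) (hn : 2 ≤ n) (r : ℝ) (hr : 0 < r) (hr1 : r ≤ 1) :
    sqMeasure n (good n r)ᶜ ≤
      ENNReal.ofReal (Real.exp (-((n * r) ^ 2 / 36)) + 5 ^ 6 * ((n : ℝ) ^ ((2 : ℝ) / 3) * r) ^ 6) := by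
  have hm : 0 < ⌈2 / r⌉₊ := Nat.ceil_pos.2 (by positivity)
  have hm' : (0 : ℝ) < (⌈2 / r⌉₊ : ℝ) := by exact_mod_cast hm
  have hle := Nat.le_ceil (2 / r)
  have hlt := Nat.ceil_lt_add_one (a := 2 / r) (by positivity)
  refine (bad_le n r hr ⌈2 / r⌉₊ hm ?_).trans (ENNReal.ofReal_le_ofReal ?_)
  · rw [div_le_iff₀ hr] at hle
    rw [div_le_iff₀ hm']
    linarith
  have hn' : (2 : ℝ) ≤ n := by exact_mod_cast hn
  apply add_le_add
  · apply Real.exp_le_exp.2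
    apply neg_le_neg
    rw [le_div_iff₀ (by positivity)]
    have h3 : (⌈2 / r⌉₊ : ℝ) * r ≤ 3 := by
      calc (⌈2 / r⌉₊ : ℝ) * r ≤ (2 / r + 1) * r := by gcongr
        _ = 2 + r := by field_simp
        _ ≤ 3 := by linarith
    have h4 : ((⌈2 / r⌉₊ : ℝ) * r) ^ 2 ≤ 9 := by
      have : 0 ≤ (⌈2 / r⌉₊ : ℝ) * r := by positivity
      nlinarith
    have e : ∀ u : ℝ, ((n : ℝ) * r) ^ 2 / 36 * u ^ 2 = (n : ℝ) ^ 2 / 36 * (u * r) ^ 2 := by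
      intro u; ring
    rw [e]
    calc (n : ℝ) ^ 2 / 36 * ((⌈2 / r⌉₊ : ℝ) * r) ^ 2
        ≤ (n : ℝ) ^ 2 / 36 * 9 := by gcongr
      _ ≤ _ := by nlinarith
  · apply le_of_eq
    have : ((n : ℝ) ^ ((2 : ℝ) / 3)) ^ 6 = n ^ 4 := by
      rw [← Real.rpow_natCast, ← Real.rpow_mul (by positivity), ← Real.rpow_natCast]
      norm_num
    rw [mul_pow, mul_pow, this]
    ring

theorem every_edge_free (r : ℕ → ℝ) (hrpos : ∀ n, 0 < r n)
    (hr1 : Tendsto (fun n : ℕ => (n : ℝ) * r n) atTop atTop)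
    (hr2 : Tendsto (fun n : ℕ => (n : ℝ) ^ ((2 : ℝ) / 3) * r n) atTop (nhds 0)) :
    Tendsto
      (fun n : ℕ => sqMeasure n
        {x | (∃ i j : Fin n, (geomGraph n (r n) x).Adj i j) ∧
          ∀ i j : Fin n, (geomGraph n (r n) x).Adj i j → IsFreeEdge n (r n) x i j})
      atTop (nhds 1) := by
  change Tendsto (fun n : ℕ => sqMeasure n (good n (r n))) atTop (nhds 1)
  have hbad : Tendsto (fun n : ℕ => sqMeasure n (good n (r n))ᶜ) atTop (nhds 0) := by
    have hlim : Tendsto (fun n : ℕ => ENNReal.ofReal (Real.exp (-((n * r n) ^ 2 / 36)) +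
        5 ^ 6 * ((n : ℝ) ^ ((2 : ℝ) / 3) * r n) ^ 6)) atTop (nhds 0) := by
      rw [← ENNReal.ofReal_zero]
      apply ENNReal.tendsto_ofReal
      have hA : Tendsto (fun n : ℕ => Real.exp (-((n * r n) ^ 2 / 36))) atTop (nhds 0) := by
        apply Real.tendsto_exp_neg_atTop_nhds_zero.comp
        exact ((tendsto_pow_atTop two_ne_zero).comp hr1).atTop_div_const (by norm_num)
      have hB := (hr2.pow 6).const_mul (5 ^ 6 : ℝ)
      simpa using hA.add hB
    refine tendsto_of_tendsto_of_tendsto_of_le_of_le' tendsto_const_nhds hlim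
      (Eventually.of_forall fun _ => bot_le) ?_
    filter_upwards [eventually_ge_atTop 2, hr2.eventually (gt_mem_nhds one_pos)] with n hn h1
    refine bad_le' n hn (r n) (hrpos n) ?_
    have : (1 : ℝ) ≤ (n : ℝ) ^ ((2 : ℝ) / 3) := by
      apply Real.one_le_rpow _ (by norm_num)
      exact_mod_cast (by omega : 1 ≤ n)
    nlinarith [hrpos n]
  have hlow : Tendsto (fun n : ℕ => 1 - sqMeasure n (good n (r n))ᶜ) atTop (nhds 1) := by
    simpa using ENNReal.Tendsto.sub (tendsto_const_nhds (x := (1 : ENNReal))) hbad (by simp)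
  refine tendsto_of_tendsto_of_tendsto_of_le_of_le hlow tendsto_const_nhds ?_
    (fun n => prob_le_one)
  intro n
  change 1 - sqMeasure n (good n (r n))ᶜ ≤ sqMeasure n (good n (r n))
  rw [tsub_le_iff_right]
  have := measure_union_le (μ := sqMeasure n) (good n (r n)) (good n (r n))ᶜ
  rwa [Set.union_compl_self, measure_univ] at this
end
end

section
/- Let k : ℕ → ℕ and r : ℕ → ℝ be functions with 1 ≤ k(n) ≤ n/(4·ln n) and 0 < r(n) ≤ 1/(2·√(k(n))) for all sufficiently large n. Then the probability that the toroidal random geometric graph G(n, r(n)) contains an independent set of size k(n) tends to 1 as n → ∞. -/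
open MeasureTheory Filter

noncomputable section

/-- The half-open unit square `[0,1)²`, viewed as the unit flat torus. -/
def torusSquare : Set (EuclideanSpace ℝ (Fin 2)) := {x | ∀ i, x i ∈ Set.Ico (0 : ℝ) 1}

/-- The distribution of `n` independent uniform points on `[0,1)²`. -/
def torusMeasure (n : ℕ) : Measure (Fin n → EuclideanSpace ℝ (Fin 2)) :=
  Measure.pi fun _ => volume.restrict torusSquare

/-- The toroidal distance: `d(x,y)` is the infimum of `‖x - y + v‖` over
shifts `v ∈ {-1,0,1}²`. -/
def torusDist (x y : EuclideanSpace ℝ (Fin 2)) : ℝ :=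
  sInf {d : ℝ | ∃ v : EuclideanSpace ℝ (Fin 2),
    (∀ i, v i ∈ ({-1, 0, 1} : Set ℝ)) ∧ d = ‖x - y + v‖}

/-- The event that the toroidal random geometric graph with distance parameter `r` contains
an independent set of size `k`: `k` vertices, no two of which are within toroidal
distance `r`. -/
def HasIndepSet (n : ℕ) (r : ℝ) (k : ℕ) (x : Fin n → EuclideanSpace ℝ (Fin 2)) : Prop :=
  ∃ S : Finset (Fin n), S.card = k ∧
    ∀ i ∈ S, ∀ j ∈ S, i ≠ j → ¬ torusDist (x i) (x j) ≤ r

def shiftF : Set (EuclideanSpace ℝ (Fin 2)) := {v | ∀ i, v i ∈ ({-1, 0, 1} : Set ℝ)}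

lemma shiftF_finite : shiftF.Finite := by
  have h : (Set.pi Set.univ (fun _ : Fin 2 => ({-1, 0, 1} : Set ℝ))).Finite :=
    Set.Finite.pi' (fun _ => by simp)  |>.subset (fun v hv i => hv i (Set.mem_univ i))
  refine (h.image (WithLp.toLp 2)).subset ?_
  intro v hv
  exact ⟨v.ofLp, fun i _ => hv i, rfl⟩

def near (r : ℝ) (x y : EuclideanSpace ℝ (Fin 2)) : Prop := ∃ v ∈ shiftF, ‖x - y + v‖ ≤ r

lemma near_symm {r : ℝ} {x y : EuclideanSpace ℝ (Fin 2)} (h : near r x y) : near r y x := by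
  obtain ⟨v, hv, h⟩ := h
  refine ⟨-v, ?_, ?_⟩
  · intro i
    have := hv i
    simp only [Set.mem_insert_iff, Set.mem_singleton_iff, PiLp.neg_apply] at this ⊢
    rcases this with h | h | h <;> simp [h]
  · have e : y - x + -v = -(x - y + v) := by abel
    rw [e, norm_neg]
    exact h

lemma near_of_dist {r : ℝ} {x y : EuclideanSpace ℝ (Fin 2)} (h : torusDist x y ≤ r) :
    near r x y := by
  have hE : {d : ℝ | ∃ v : EuclideanSpace ℝ (Fin 2),
    (∀ i, v i ∈ ({-1, 0, 1} : Set ℝ)) ∧ d = ‖x - y + v‖} = (fun v => ‖x - y + v‖) '' shiftF := by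
    ext d
    constructor
    · rintro ⟨v, hv, rfl⟩; exact ⟨v, hv, rfl⟩
    · rintro ⟨v, hv, rfl⟩; exact ⟨v, hv, rfl⟩
  unfold torusDist at h
  rw [hE] at h
  have hne : shiftF.Nonempty := ⟨0, fun i => by simp⟩
  obtain ⟨v, hv, hv'⟩ := (hne.image _).csInf_mem (shiftF_finite.image (fun v => ‖x - y + v‖))
  refine ⟨v, hv, ?_⟩
  rw [← hv'] at h
  exact h

lemma near_closed (r : ℝ) :
    IsClosed {p : EuclideanSpace ℝ (Fin 2) × EuclideanSpace ℝ (Fin 2) | near r p.1 p.2} := by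
  have : {p : EuclideanSpace ℝ (Fin 2) × EuclideanSpace ℝ (Fin 2) | near r p.1 p.2} =
      ⋃ v ∈ shiftF, {p | ‖p.1 - p.2 + v‖ ≤ r} := by
    ext p; simp [near]
  rw [this]
  refine shiftF_finite.isClosed_biUnion fun v _ => ?_
  exact isClosed_le (by fun_prop) continuous_const

lemma torusSquare_meas : MeasurableSet torusSquare := by
  have : torusSquare = ⋂ i : Fin 2, (fun x : EuclideanSpace ℝ (Fin 2) => x i) ⁻¹' Set.Ico (0 : ℝ) 1 := by
    ext; simp [torusSquare]
  rw [this]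
  refine MeasurableSet.iInter fun i => ?_
  have : Measurable (fun x : EuclideanSpace ℝ (Fin 2) => x i) := by fun_prop
  exact this measurableSet_Ico

lemma torusSquare_vol : volume torusSquare = 1 := by
  have h := (EuclideanSpace.volume_preserving_symm_measurableEquiv_toLp (Fin 2)).symm
  have := (EuclideanSpace.volume_preserving_symm_measurableEquiv_toLp (Fin 2)).measure_preimage_equiv
    (Set.pi Set.univ (fun _ => Set.Ico (0 : ℝ) 1))
  have e : torusSquare = ((MeasurableEquiv.toLp 2 (Fin 2 → ℝ)).symm ⁻¹' (Set.pi Set.univ (fun _ => Set.Ico (0 : ℝ) 1))) := by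
    ext x; simp [torusSquare]
  rw [e, this, Real.volume_pi_Ico]
  simp

instance : IsProbabilityMeasure (volume.restrict torusSquare) :=
  ⟨by rw [Measure.restrict_apply_univ, torusSquare_vol]⟩

lemma near_vol (r : ℝ) (x : EuclideanSpace ℝ (Fin 2)) :
    volume.restrict torusSquare {y | near r y x} ≤ volume (Metric.closedBall (0 : EuclideanSpace ℝ (Fin 2)) r) := by
  rw [Measure.restrict_apply' torusSquare_meas]
  have : Countable shiftF := shiftF_finite.countable
  let A : shiftF → Set (EuclideanSpace ℝ (Fin 2)) := fun v =>
    Metric.closedBall 0 r ∩ (fun z => z + (x - v)) ⁻¹' torusSquare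
  have hAm : ∀ v, MeasurableSet (A v) := fun v =>
    Metric.isClosed_closedBall.measurableSet.inter ((measurable_add_const _) torusSquare_meas)
  have hAd : Pairwise (Function.onFun Disjoint A) := by
    intro v w hvw
    refine Set.disjoint_left.2 ?_
    rintro z ⟨_, h1⟩ ⟨_, h2⟩
    apply hvw
    ext i
    have a := h1 i
    have b := h2 i
    have c := v.2 i
    have d := w.2 i
    simp only [Set.mem_Ico, PiLp.add_apply, PiLp.sub_apply, Set.mem_insert_iff, Set.mem_singleton_iff] at a b c d
    rcases c with c | c | c <;> rcases d with d | d | d <;> rw [c, d] <;> rw [c] at a <;> rw [d] at b <;> linarith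
  have hsub : {y | near r y x} ∩ torusSquare ⊆ ⋃ v : shiftF, (fun z => z + (-(x - v))) ⁻¹' A v := by
    rintro y ⟨⟨v, hv, h⟩, hy⟩
    refine Set.mem_iUnion.2 ⟨⟨v, hv⟩, ?_, ?_⟩
    · rw [mem_closedBall_zero_iff]
      have e : y + -(x - v) = y - x + v := by abel
      change ‖y + -(x - v)‖ ≤ r
      rw [e]; exact h
    · change y + -(x - v) + (x - v) ∈ torusSquare
      rw [neg_add_cancel_right]; exact hy
  calc _ ≤ volume (⋃ v : shiftF, (fun z => z + (-(x - v))) ⁻¹' A v) := measure_mono hsub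
    _ ≤ ∑' v : shiftF, volume ((fun z => z + (-(x - v))) ⁻¹' A v) := measure_iUnion_le _
    _ = ∑' v : shiftF, volume (A v) := by simp_rw [measure_preimage_add_right]
    _ = volume (⋃ v, A v) := (measure_iUnion hAd hAm).symm
    _ ≤ _ := measure_mono (Set.iUnion_subset fun v => Set.inter_subset_left)

lemma badS_bound (n k : ℕ) (r : ℝ) (hk : 1 ≤ k) (hr : 0 < r) (hrk : r ≤ 1 / (2 * Real.sqrt k))
    (S : Finset (Fin n)) (hS : S.card = k - 1) :
    torusMeasure n {x | ∀ i ∉ S, ∃ j ∈ S, near r (x i) (x j)} ≤ ENNReal.ofReal (0.8 ^ (n - (k - 1))) := by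
  classical
  have hball : ((k - 1 : ℕ) : ENNReal) * volume (Metric.closedBall (0 : EuclideanSpace ℝ (Fin 2)) r) ≤ ENNReal.ofReal 0.8 := by
    rw [EuclideanSpace.volume_closedBall_fin_two, ← ENNReal.ofReal_natCast,
      ← ENNReal.ofReal_pow hr.le, ← ENNReal.ofReal_mul (by positivity),
      ← ENNReal.ofReal_mul (by positivity)]
    apply ENNReal.ofReal_le_ofReal
    have hk0 : (0 : ℝ) < k := by exact_mod_cast hk
    have hr2 : r ^ 2 ≤ 1 / (4 * k) := by
      calc r ^ 2 ≤ (1 / (2 * Real.sqrt (k : ℝ))) ^ 2 := by gcongr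
        _ = 1 / (4 * (k : ℝ)) := by rw [div_pow, mul_pow, Real.sq_sqrt hk0.le]; norm_num
    have hkk : ((k - 1 : ℕ) : ℝ) ≤ k := by exact_mod_cast Nat.sub_le k 1
    calc ((k - 1 : ℕ) : ℝ) * (r ^ 2 * Real.pi) ≤ (k : ℝ) * (1 / (4 * (k : ℝ)) * 3.15) := by
          gcongr; exact Real.pi_lt_d2.le
      _ ≤ 0.8 := by field_simp; norm_num
  let B : Set ((({i // i ∈ S}) → EuclideanSpace ℝ (Fin 2)) × (({i // ¬ i ∈ S}) → EuclideanSpace ℝ (Fin 2))) :=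
    {p | ∀ i, ∃ j, near r (p.2 i) (p.1 j)}
  have hB : MeasurableSet B := by
    have : B = ⋂ i, ⋃ j, (fun p => (p.2 i, p.1 j)) ⁻¹' {q : EuclideanSpace ℝ (Fin 2) × EuclideanSpace ℝ (Fin 2) | near r q.1 q.2} := by
      ext p; simp [B]
    rw [this]
    refine MeasurableSet.iInter fun i => MeasurableSet.iUnion fun j => ?_
    have : Measurable (fun p : (({i // i ∈ S}) → EuclideanSpace ℝ (Fin 2)) × (({i // ¬ i ∈ S}) → EuclideanSpace ℝ (Fin 2)) => (p.2 i, p.1 j)) := by fun_prop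
    exact this (near_closed r).measurableSet
  have hmp := measurePreserving_piEquivPiSubtypeProd (fun _ : Fin n => volume.restrict torusSquare) (fun i => i ∈ S)
  have e : {x : Fin n → EuclideanSpace ℝ (Fin 2) | ∀ i ∉ S, ∃ j ∈ S, near r (x i) (x j)} =
      (MeasurableEquiv.piEquivPiSubtypeProd (fun _ : Fin n => EuclideanSpace ℝ (Fin 2)) (fun i => i ∈ S)) ⁻¹' B := by
    ext x
    simp [B, MeasurableEquiv.piEquivPiSubtypeProd, Equiv.piEquivPiSubtypeProd]
  unfold torusMeasure
  rw [e, hmp.measure_preimage_equiv, Measure.prod_apply hB]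
  refine (lintegral_mono (g := fun _ => ENNReal.ofReal (0.8 ^ (n - (k - 1)))) ?_).trans ?_
  · intro u
    have e2 : Prod.mk u ⁻¹' B = Set.pi Set.univ (fun _ => ⋃ j, {y | near r y (u j)}) := by
      ext w; simp [B]
    simp only
    rw [e2, Measure.pi_pi, Finset.prod_const, ENNReal.ofReal_pow (by norm_num)]
    have hc : (Finset.univ : Finset {i // ¬ i ∈ S}).card = n - (k - 1) := by
      rw [Finset.card_univ, Fintype.card_subtype_compl]; simp [hS]
    rw [hc]
    gcongr
    refine le_trans ((measure_iUnion_fintype_le _ _).trans (Finset.sum_le_sum fun j _ => near_vol r (u j))) ?_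
    simpa [hS] using hball
  · simp

lemma bad_sub (n k : ℕ) (r : ℝ) (hk : 1 ≤ k) (hkn : k ≤ n) (x : Fin n → EuclideanSpace ℝ (Fin 2))
    (hx : ¬ HasIndepSet n r k x) :
    ∃ S ∈ Finset.powersetCard (k - 1) (Finset.univ : Finset (Fin n)), ∀ i ∉ S, ∃ j ∈ S, near r (x i) (x j) := by
  classical
  let I : Finset (Finset (Fin n)) := Finset.univ.filter
    (fun S => ∀ i ∈ S, ∀ j ∈ S, i ≠ j → ¬ torusDist (x i) (x j) ≤ r)
  obtain ⟨M, hM, hmax⟩ := I.exists_max_image Finset.card ⟨∅, by simp [I]⟩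
  have hM' : ∀ i ∈ M, ∀ j ∈ M, i ≠ j → ¬ torusDist (x i) (x j) ≤ r := by simpa [I] using hM
  have hMk : M.card ≤ k - 1 := by
    by_contra hcon
    obtain ⟨T, hT, hTc⟩ := Finset.exists_subset_card_eq (show k ≤ M.card by omega)
    exact hx ⟨T, hTc, fun i hi j hj => hM' i (hT hi) j (hT hj)⟩
  obtain ⟨S, hMS, -, hSc⟩ := Finset.exists_subsuperset_card_eq (Finset.subset_univ M) hMk
    (by simp; omega)
  refine ⟨S, by simp [Finset.mem_powersetCard, hSc], fun i hi => ?_⟩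
  have hiM : i ∉ M := fun h => hi (hMS h)
  by_contra! hcon
  have : insert i M ∈ I := by
    simp only [I, Finset.mem_filter, Finset.mem_univ, true_and]
    intro a ha b hb hab hd
    rw [Finset.mem_insert] at ha hb
    rcases ha with rfl | ha <;> rcases hb with rfl | hb
    · exact hab rfl
    · exact hcon b (hMS hb) (near_of_dist hd)
    · exact hcon a (hMS ha) (near_symm (near_of_dist hd))
    · exact hM' a ha b hb hab hd
  have := hmax _ this
  rw [Finset.card_insert_of_notMem hiM] at this
  omega

lemma choose_bound (n j : ℕ) (h : 100 * j ≤ n) : (n.choose j : ℝ) * 0.8 ^ (n - j) ≤ 0.91 ^ n := by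
  have h1 : (n.choose j : ℝ) * 0.1 ^ j ≤ 1.1 ^ n := by
    have := add_pow (0.1 : ℝ) 1 n
    rw [show (1.1 : ℝ) = 0.1 + 1 by norm_num, this]
    refine le_trans (le_of_eq ?_) (Finset.single_le_sum (f := fun m => (0.1 : ℝ) ^ m * 1 ^ (n - m) * (n.choose m)) (fun i _ => by positivity) (Finset.mem_range.2 (show j < n + 1 by omega)))
    simp; ring
  have h2 : (12.5 : ℝ) ^ j ≤ 1.03 ^ n := by
    calc (12.5 : ℝ) ^ j ≤ (1.03 ^ 100) ^ j := by gcongr; norm_num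
      _ = 1.03 ^ (100 * j) := by rw [pow_mul]
      _ ≤ _ := pow_le_pow_right₀ (by norm_num) h
  have h3 : (0.8 : ℝ) ^ (n - j) * 0.8 ^ j = 0.8 ^ n := by rw [← pow_add]; congr 1; omega
  have h4 : (0.1 : ℝ) ^ j * (0.8 ^ j * 12.5 ^ j) = 1 := by
    rw [← mul_pow, ← mul_pow]; norm_num
  calc (n.choose j : ℝ) * 0.8 ^ (n - j) = (n.choose j : ℝ) * 0.1 ^ j * (0.8 ^ (n - j) * 0.8 ^ j) * 12.5 ^ j := by
        linear_combination (-(n.choose j : ℝ) * 0.8 ^ (n - j)) * h4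
    _ ≤ 1.1 ^ n * 0.8 ^ n * 1.03 ^ n := by rw [h3]; gcongr
    _ = (1.1 * 0.8 * 1.03) ^ n := by rw [mul_pow, mul_pow]
    _ ≤ _ := by gcongr; norm_num

theorem indep_set_exists (k : ℕ → ℕ) (r : ℕ → ℝ)
    (hkr : ∀ᶠ n : ℕ in atTop,
      1 ≤ k n ∧ (k n : ℝ) ≤ (n : ℝ) / (4 * Real.log n) ∧
        0 < r n ∧ r n ≤ 1 / (2 * Real.sqrt (k n))) :
    Tendsto (fun n : ℕ => torusMeasure n {x | HasIndepSet n (r n) (k n) x})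
      atTop (nhds 1) := by
  have hP : ∀ n, IsProbabilityMeasure (torusMeasure n) := fun n => by
    unfold torusMeasure; infer_instance
  have hlog : ∀ᶠ n : ℕ in atTop, 25 ≤ Real.log n :=
    (Real.tendsto_log_atTop.comp tendsto_natCast_atTop_atTop).eventually_ge_atTop 25
  have key : ∀ᶠ n : ℕ in atTop, 1 - ENNReal.ofReal (0.91 ^ n) ≤
      torusMeasure n {x | HasIndepSet n (r n) (k n) x} := by
    filter_upwards [hkr, hlog] with n ⟨hk, hkn, hr, hrk⟩ hl
    have h100 : 100 * k n ≤ n := by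
      have : (k n : ℝ) ≤ n / 100 := hkn.trans (by gcongr; linarith)
      have : (100 : ℝ) * k n ≤ n := by linarith
      exact_mod_cast this
    have hbad : torusMeasure n {x | HasIndepSet n (r n) (k n) x}ᶜ ≤ ENNReal.ofReal (0.91 ^ n) := by
      calc _ ≤ torusMeasure n (⋃ S ∈ Finset.powersetCard (k n - 1) (Finset.univ : Finset (Fin n)),
            {x | ∀ i ∉ S, ∃ j ∈ S, near (r n) (x i) (x j)}) := by
            refine measure_mono fun x hx => ?_
            obtain ⟨S, hS, h⟩ := bad_sub n (k n) (r n) hk (by omega) x hx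
            exact Set.mem_biUnion hS h
        _ ≤ ∑ S ∈ Finset.powersetCard (k n - 1) (Finset.univ : Finset (Fin n)),
            torusMeasure n {x | ∀ i ∉ S, ∃ j ∈ S, near (r n) (x i) (x j)} := measure_biUnion_finset_le _ _
        _ ≤ ∑ S ∈ Finset.powersetCard (k n - 1) (Finset.univ : Finset (Fin n)),
            ENNReal.ofReal (0.8 ^ (n - (k n - 1))) := Finset.sum_le_sum fun S hS =>
              badS_bound n (k n) (r n) hk hr hrk S (Finset.mem_powersetCard.1 hS).2
        _ = ENNReal.ofReal ((n.choose (k n - 1) : ℝ) * 0.8 ^ (n - (k n - 1))) := by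
            rw [ENNReal.ofReal_mul (by positivity), ENNReal.ofReal_natCast]; simp
        _ ≤ _ := ENNReal.ofReal_le_ofReal (choose_bound _ _ (by omega))
    rw [tsub_le_iff_right]
    calc (1 : ENNReal) = torusMeasure n Set.univ := measure_univ.symm
      _ ≤ torusMeasure n {x | HasIndepSet n (r n) (k n) x} + torusMeasure n {x | HasIndepSet n (r n) (k n) x}ᶜ := by
          rw [← Set.union_compl_self {x | HasIndepSet n (r n) (k n) x}]; exact measure_union_le _ _
      _ ≤ _ := by gcongr
  have hlim : Tendsto (fun n : ℕ => 1 - ENNReal.ofReal (0.91 ^ n)) atTop (nhds 1) := by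
    have h1 : Tendsto (fun n : ℕ => ENNReal.ofReal ((0.91 : ℝ) ^ n)) atTop (nhds 0) := by
      have := ENNReal.tendsto_ofReal (tendsto_pow_atTop_nhds_zero_of_lt_one (r := (0.91 : ℝ)) (by norm_num) (by norm_num))
      simpa using this
    have := ENNReal.Tendsto.sub (tendsto_const_nhds (x := (1 : ENNReal))) h1 (Or.inl ENNReal.one_ne_top)
    simpa using this
  exact tendsto_of_tendsto_of_tendsto_of_le_of_le' hlim tendsto_const_nhds key
    (Eventually.of_forall fun n => prob_le_one)
end
end
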